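/- arXiv:2505.10201 — 2 statements merged into one kernel-verified Lean document; each statement's English description precedes it below -/
import Mathlib

section
/- Let (KB, H, M) be an abduction instance over V, and for every x ∈ H let x′ be a fresh variable; set H′ = H ∪ {x′ : x ∈ H} and V′ = V ∪ {x′ : x ∈ H}. Let KB′ be the knowledge base over V′ whose models are the assignments τ : V′ → Bool whose restriction to V is a model of KB and which satisfy τ(x′) = ¬τ(x) for every x ∈ H. Then (KB′, H′, M) has a positive explanation if and only if (KB, H, M) has an explanation. (Correctness of the reduction from symmetric to positive abduction via complementary variable pairs.) -/
variable {V : Type*}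

/-- An assignment `σ` satisfies a set of literals `E`; the literal `(x, true)`
is the positive literal `x` and `(x, false)` is the negative literal `¬x`. -/
def SatLits {W : Type*} (σ : W → Bool) (E : Set (W × Bool)) : Prop :=
  ∀ l ∈ E, σ l.1 = l.2

/-- `E` is an explanation for the abduction instance `(KB, H, M)`:
`E` is a set of literals over `H`, `KB ∧ E` is satisfiable, and `KB ∧ E ⊨ M`. -/
def IsExpl {W : Type*} (KB : Set (W → Bool)) (H M : Set W)
    (E : Set (W × Bool)) : Prop :=
  (∀ l ∈ E, l.1 ∈ H) ∧ (∃ σ ∈ KB, SatLits σ E) ∧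
    ∀ σ ∈ KB, SatLits σ E → ∀ m ∈ M, σ m = true

/-- `E ⊆ H` is a positive explanation for the abduction instance `(KB, H, M)`:
`KB ∧ E` is satisfiable and `KB ∧ E ⊨ M`. -/
def IsPosExpl {W : Type*} (KB : Set (W → Bool)) (H M : Set W)
    (E : Set W) : Prop :=
  E ⊆ H ∧ (∃ σ ∈ KB, ∀ x ∈ E, σ x = true) ∧
    ∀ σ ∈ KB, (∀ x ∈ E, σ x = true) → ∀ m ∈ M, σ m = true

/-- Correctness of the reduction from symmetric to positive abduction via
complementary variable pairs: adding for every `x ∈ H` a fresh variable `x′`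
(modelled as `Sum.inr x`) forced to take the complementary value, and letting
`H′` contain all variables `x ∈ H` and all primed variables, the primed
instance has a positive explanation iff the original instance has an
explanation. -/
theorem stmt13 [Fintype V] (KB : Set (V → Bool)) (H M : Set V) :
    (∃ E : Set (V ⊕ ↥H),
        IsPosExpl
          {τ : V ⊕ ↥H → Bool |
            (fun v => τ (Sum.inl v)) ∈ KB ∧
              ∀ h : ↥H, τ (Sum.inr h) = !τ (Sum.inl ↑h)}
          (Sum.inl '' H ∪ Set.range Sum.inr)
          (Sum.inl '' M) E) ↔
      ∃ E, IsExpl KB H M E := by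
  constructor
  · rintro ⟨E, hEH, ⟨τ, ⟨hτ, hτ'⟩, hτE⟩, hent⟩
    refine ⟨{l | (Sum.inl l.1 ∈ E ∧ l.2 = true) ∨
      ∃ h : ↥H, Sum.inr h ∈ E ∧ ↑h = l.1 ∧ l.2 = false}, ?_, ⟨_, hτ, ?_⟩, ?_⟩
    · rintro ⟨v, b⟩ (⟨hv, -⟩ | ⟨h, -, rfl, -⟩)
      · simpa using hEH hv
      · exact h.2
    · rintro ⟨v, b⟩ (⟨hv, rfl⟩ | ⟨h, hh, rfl, rfl⟩)
      · exact hτE _ hv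
      · simpa [hτ' h] using hτE _ hh
    · intro σ hσ hsat m hm
      refine hent (Sum.elim σ fun h => !σ h) ⟨hσ, fun _ => rfl⟩ ?_ _ ⟨m, hm, rfl⟩
      rintro (v | h) hx
      · exact hsat (v, true) (Or.inl ⟨hx, rfl⟩)
      · simpa using hsat (↑h, false) (Or.inr ⟨h, hx, rfl, rfl⟩)
  · rintro ⟨E, hEH, ⟨σ, hσ, hsat⟩, hent⟩
    refine ⟨{x | x.elim (fun v => (v, true) ∈ E) fun h => (↑h, false) ∈ E}, ?_,
      ⟨Sum.elim σ fun h => !σ h, ⟨hσ, fun _ => rfl⟩, ?_⟩, ?_⟩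
    · rintro (v | h) hx
      · exact Or.inl ⟨v, hEH _ hx, rfl⟩
      · exact Or.inr ⟨h, rfl⟩
    · rintro (v | h) hx
      · exact hsat _ hx
      · simpa using hsat _ hx
    · rintro τ ⟨hτ, hτ'⟩ hτE _ ⟨m, hm, rfl⟩
      refine hent _ hτ ?_ m hm
      rintro ⟨v, _ | _⟩ hl
      · simpa [hτ' ⟨v, hEH _ hl⟩] using hτE (Sum.inr ⟨v, hEH _ hl⟩) hl
      · exact hτE (Sum.inl v) hl
end

section
/- Let φ be a CNF formula over a finite variable set X (a finite set of clauses, each a finite set of literals over X). For each x ∈ X introduce two fresh variables x′ and m_x, and let V = X ∪ {x′ : x ∈ X} ∪ {m_x : x ∈ X}. Let KB over V consist of all assignments τ such that: for every clause C of φ, some negative literal ¬x of C has τ(x) = false or some positive literal x of C has τ(x′) = false; and for every x ∈ X: not both τ(x) = true and τ(x′) = true, τ(x) = true implies τ(m_x) = true, and τ(x′) = true implies τ(m_x) = true. Let H = X ∪ {x′ : x ∈ X} and M = {m_x : x ∈ X}. Then the following are equivalent: (i) φ is satisfiable; (ii) (KB, H, M) has a positive explanation; (iii) (KB, H, M) has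 an explanation. (Correctness of the reduction from CNF-SAT to (P-)ABD(CNF⁻ ∪ IMP) underlying the SETH lower bounds, in which |H| = 2·|X| and |M| = |X|.) -/
/-- The variable `(x, 0)` plays the role of `x`, `(x, 1)` the role of `x′`,
and `(x, 2)` the role of `m_x`.  `KB17 φ` consists of the assignments
satisfying every clause `C'` (each positive literal `x` of `C` replaced by
`¬x′`, negative literals `¬x` kept) and, for every `x`:
`¬x ∨ ¬x′`, `x → m_x`, `x′ → m_x`. -/
def KB17 {X : Type*} (φ : Finset (Finset (X × Bool))) :
    Set (X × Fin 3 → Bool) :=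
  {τ | (∀ C ∈ φ, ∃ l ∈ C,
        (l.2 = false ∧ τ (l.1, 0) = false) ∨ (l.2 = true ∧ τ (l.1, 1) = false)) ∧
    ∀ x : X, ¬(τ (x, 0) = true ∧ τ (x, 1) = true) ∧
      (τ (x, 0) = true → τ (x, 2) = true) ∧ (τ (x, 1) = true → τ (x, 2) = true)}

/-- The hypotheses: all variables `x` and `x′`. -/
def H17 (X : Type*) : Set (X × Fin 3) := {p | p.2 = 0 ∨ p.2 = 1}

/-- The manifestations: all variables `m_x`. -/
def M17 (X : Type*) : Set (X × Fin 3) := {p | p.2 = 2}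

/-- A positive explanation, read as a set of positive literals, is an explanation. -/
theorem IsPosExpl.isExpl {W : Type*} {KB : Set (W → Bool)} {H M E : Set W}
    (h : IsPosExpl KB H M E) : IsExpl KB H M {l | l.1 ∈ E ∧ l.2 = true} := by
  have key (σ : W → Bool) :
      SatLits σ {l | l.1 ∈ E ∧ l.2 = true} ↔ ∀ x ∈ E, σ x = true :=
    ⟨fun hσ x hx => hσ (x, true) ⟨hx, rfl⟩, fun hσ l hl => (hσ l.1 hl.1).trans hl.2.symm⟩
  obtain ⟨hEH, ⟨σ, hσ, hσE⟩, hM⟩ := h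
  exact ⟨fun l hl => hEH hl.1, ⟨σ, hσ, (key σ).2 hσE⟩, fun τ hτ hτE => hM τ hτ ((key τ).1 hτE)⟩

/-- A satisfying assignment `σ` yields the positive explanation consisting of the `x`
with `σ x` true and the `x′` with `σ x` false. -/
theorem isPosExpl_of_sat {X : Type*} {φ : Finset (Finset (X × Bool))} {σ : X → Bool}
    (hσ : ∀ C ∈ φ, ∃ l ∈ C, σ l.1 = l.2) :
    IsPosExpl (KB17 φ) (H17 X) (M17 X)
      {p | (p.2 = 0 ∧ σ p.1 = true) ∨ (p.2 = 1 ∧ σ p.1 = false)} := by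
  refine ⟨fun p hp => hp.imp And.left And.left,
    ⟨fun p => if p.2 = 0 then σ p.1 else if p.2 = 1 then !σ p.1 else true, ⟨?_, ?_⟩, ?_⟩, ?_⟩
  · intro C hC
    obtain ⟨l, hl, h⟩ := hσ C hC
    refine ⟨l, hl, ?_⟩
    cases h2 : l.2 <;> simp [h, h2]
  · intro x
    simp
  · rintro ⟨x, i⟩ (⟨rfl, h⟩ | ⟨rfl, h⟩) <;> simpa using h
  · rintro τ ⟨-, hτ⟩ hE ⟨x, i⟩ rfl
    cases h : σ x
    · exact (hτ x).2.2 (hE (x, 1) (Or.inr ⟨rfl, h⟩))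
    · exact (hτ x).2.1 (hE (x, 0) (Or.inl ⟨rfl, h⟩))

/-- If the abduction instance has an explanation, the formula is satisfiable: setting each
`m_x` to the least value allowed preserves the model, so one of `x`, `x′` is always true. -/
theorem sat_of_isExpl {X : Type*} {φ : Finset (Finset (X × Bool))} {E : Set ((X × Fin 3) × Bool)}
    (h : IsExpl (KB17 φ) (H17 X) (M17 X) E) :
    ∃ σ : X → Bool, ∀ C ∈ φ, ∃ l ∈ C, σ l.1 = l.2 := by
  obtain ⟨hEH, ⟨τ, ⟨hC, hτ⟩, hE⟩, hM⟩ := h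
  have cover (x : X) : τ (x, 0) = true ∨ τ (x, 1) = true := by
    have hx := hM (fun p => if p.2 = 2 then τ (p.1, 0) || τ (p.1, 1) else τ p)
      ⟨by simpa using hC, fun x => by
        have := (hτ x).1
        simp_all⟩
      (fun l hl => by
        have hne : l.1.2 ≠ 2 := by rcases hEH l hl with h | h <;> simp [h]
        simpa [hne] using hE l hl)
      (x, 2) rfl
    simpa using hx
  refine ⟨fun x => τ (x, 0), fun C hCφ => ?_⟩
  obtain ⟨l, hl, ⟨h2, h⟩ | ⟨h2, h⟩⟩ := hC C hCφ
  · exact ⟨l, hl, h.trans h2.symm⟩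
  · exact ⟨l, hl, ((cover l.1).resolve_right (by simp [h])).trans h2.symm⟩

/-- Correctness of the reduction from CNF-SAT to (P-)ABD(CNF⁻ ∪ IMP)
underlying the SETH lower bounds: the CNF formula `φ` is satisfiable iff the
abduction instance `(KB17 φ, H17, M17)` has a positive explanation, iff it
has an explanation. -/
theorem stmt17 (X : Type*) [Fintype X] [DecidableEq X]
    (φ : Finset (Finset (X × Bool))) :
    ((∃ σ : X → Bool, ∀ C ∈ φ, ∃ l ∈ C, σ l.1 = l.2) ↔
        ∃ E, IsPosExpl (KB17 φ) (H17 X) (M17 X) E) ∧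
      ((∃ σ : X → Bool, ∀ C ∈ φ, ∃ l ∈ C, σ l.1 = l.2) ↔
        ∃ E, IsExpl (KB17 φ) (H17 X) (M17 X) E) := by
  exact ⟨⟨fun ⟨_, hσ⟩ => ⟨_, isPosExpl_of_sat hσ⟩, fun ⟨_, hE⟩ => sat_of_isExpl hE.isExpl⟩,
    ⟨fun ⟨_, hσ⟩ => ⟨_, (isPosExpl_of_sat hσ).isExpl⟩, fun ⟨_, hE⟩ => sat_of_isExpl hE⟩⟩
end
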